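/- arXiv:2012.00003 — 8 statements merged into one kernel-verified Lean document; each statement's English description precedes it below -/
import Mathlib

section
/- Let X and Y be real Banach spaces and let Z = X ⊕₁ Y be their ℓ¹-direct sum (so ‖(x,y)‖ = ‖x‖ + ‖y‖). If x₀ is a denting point of the closed unit ball B_X, then (x₀, 0) is a denting point of the closed unit ball B_Z. -/
/-- The slice of the closed unit ball `B_X` determined by a functional `f` and `α > 0`:
`{y ∈ B_X : f y > 1 - α}`. -/
def ballSlice {X : Type*} [NormedAddCommGroup X] [NormedSpace ℝ X]
    (f : X →L[ℝ] ℝ) (α : ℝ) : Set X :=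
  {y | ‖y‖ ≤ 1 ∧ 1 - α < f y}

/-- `x` is a denting point of the closed unit ball `B_X`: for every `ε > 0` there is a
slice of `B_X` (given by a norm-one functional) containing `x` of diameter `< ε`. -/
def IsDentingPoint {X : Type*} [NormedAddCommGroup X] [NormedSpace ℝ X] (x : X) : Prop :=
  ‖x‖ ≤ 1 ∧ ∀ ε > 0, ∃ (f : X →L[ℝ] ℝ) (α : ℝ), ‖f‖ = 1 ∧ 0 < α ∧
    x ∈ ballSlice f α ∧ Metric.diam (ballSlice f α) < ε

/-- If `x₀` is a denting point of `B_X`, then `(x₀, 0)` is a denting point of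
the unit ball of the ℓ¹-direct sum `Z = X ⊕₁ Y`. -/
theorem denting_point_of_l1_sum
    {X Y : Type*} [NormedAddCommGroup X] [NormedSpace ℝ X] [CompleteSpace X]
    [NormedAddCommGroup Y] [NormedSpace ℝ Y] [CompleteSpace Y]
    (x₀ : X) (h : IsDentingPoint x₀) :
    IsDentingPoint ((WithLp.equiv 1 (X × Y)).symm (x₀, 0)) := by
  obtain ⟨hx₀, H⟩ := h
  have nrm : ∀ z : WithLp 1 (X × Y), ‖z‖ = ‖z.fst‖ + ‖z.snd‖ := fun z =>
    WithLp.prod_norm_eq_of_L1 z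
  have nx : ∀ x : X, ‖(WithLp.toLp 1 (x, (0 : Y)))‖ = ‖x‖ := fun x => by
    rw [nrm]; simp
  change IsDentingPoint (WithLp.toLp 1 (x₀, (0 : Y)))
  refine ⟨by rw [nx]; exact hx₀, fun ε hε => ?_⟩
  obtain ⟨f, α, hf, hα, hx, hd⟩ := H (ε / 4) (by positivity)
  let g : WithLp 1 (X × Y) →L[ℝ] ℝ :=
    f.comp ((ContinuousLinearMap.fst ℝ X Y).comp
      (WithLp.prodContinuousLinearEquiv 1 ℝ X Y).toContinuousLinearMap)
  have hg : ∀ z, g z = f z.fst := fun z => rfl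
  have hgn : ‖g‖ = 1 := by
    apply le_antisymm
    · refine ContinuousLinearMap.opNorm_le_bound _ zero_le_one fun z => ?_
      have h1 := f.le_opNorm z.fst
      rw [hf] at h1
      rw [hg, nrm]
      linarith [norm_nonneg z.snd]
    · rw [← hf]
      refine ContinuousLinearMap.opNorm_le_bound _ (norm_nonneg _) fun x => ?_
      have h1 := g.le_opNorm (WithLp.toLp 1 (x, (0 : Y)))
      rw [nx] at h1
      exact h1
  have hb : Bornology.IsBounded (ballSlice f α) :=
    (Metric.isBounded_closedBall (x := (0 : X)) (r := 1)).subset fun y hy => by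
      simpa using hy.1
  obtain ⟨u, hu, hfu⟩ : ∃ u : X, ‖u‖ = 1 ∧ 0 ≤ f u := by
    have hne : ∃ v : X, v ≠ 0 := by
      by_contra! hc
      have : f = 0 := by ext v; simp [hc v]
      simp [this] at hf
    obtain ⟨v, hv⟩ := hne
    have hw : ‖(‖v‖⁻¹ • v)‖ = 1 := by
      rw [norm_smul, norm_inv, norm_norm, inv_mul_cancel₀ (norm_ne_zero_iff.2 hv)]
    rcases le_total 0 (f (‖v‖⁻¹ • v)) with h0 | h0
    · exact ⟨_, hw, h0⟩
    · exact ⟨-(‖v‖⁻¹ • v), by rw [norm_neg, hw], by rw [map_neg]; linarith⟩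
  have key : ∀ z ∈ ballSlice g α, z.fst ∈ ballSlice f α ∧
      ‖z.snd‖ ≤ Metric.diam (ballSlice f α) := by
    rintro z ⟨hz1, hz2⟩
    rw [nrm] at hz1
    rw [hg] at hz2
    have m1 : z.fst ∈ ballSlice f α := ⟨by linarith [norm_nonneg z.snd], hz2⟩
    have hru : ‖(‖z.snd‖ • u)‖ = ‖z.snd‖ := by
      rw [norm_smul, norm_norm, hu, mul_one]
    have m2 : z.fst + ‖z.snd‖ • u ∈ ballSlice f α := by
      refine ⟨(norm_add_le _ _).trans (by rw [hru]; exact hz1), ?_⟩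
      rw [map_add, map_smul, smul_eq_mul]
      have := mul_nonneg (norm_nonneg z.snd) hfu
      linarith
    refine ⟨m1, ?_⟩
    have := Metric.dist_le_diam_of_mem hb m2 m1
    rwa [dist_eq_norm, add_sub_cancel_left, hru] at this
  refine ⟨g, α, hgn, hα, ⟨by rw [nx]; exact hx₀, hx.2⟩, ?_⟩
  have hD : 0 ≤ Metric.diam (ballSlice f α) := Metric.diam_nonneg
  refine lt_of_le_of_lt (Metric.diam_le_of_forall_dist_le
    (C := 3 * Metric.diam (ballSlice f α)) (by positivity) ?_) (by linarith)
  intro z hz w hw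
  obtain ⟨z1, z2⟩ := key z hz
  obtain ⟨w1, w2⟩ := key w hw
  have h1 := Metric.dist_le_diam_of_mem hb z1 w1
  rw [dist_eq_norm] at h1
  have h2 := norm_sub_le z.snd w.snd
  rw [dist_eq_norm, nrm, WithLp.sub_fst, WithLp.sub_snd]
  linarith
end

section
/- Let X and Y be real Banach spaces and let Z = X ⊕_∞ Y be their ℓ∞-direct sum, so that Z* is isometrically X* ⊕₁ Y*. If x₀* is a w*-denting point of the closed unit ball B_{X*}, then the functional on Z given by (x,y) ↦ x₀*(x) is a w*-denting point of B_{Z*}. -/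
/-- The w*-slice of the closed dual unit ball `B_{X*}` determined by `x ∈ X` and `α > 0`:
`{f ∈ B_{X*} : f x > 1 - α}`. -/
def wStarSlice (X : Type*) [NormedAddCommGroup X] [NormedSpace ℝ X] (x : X) (α : ℝ) :
    Set (X →L[ℝ] ℝ) :=
  {f | ‖f‖ ≤ 1 ∧ 1 - α < f x}

/-- `f` is a w*-denting point of the closed dual unit ball `B_{X*}`: for every `ε > 0`
there is a w*-slice of `B_{X*}` containing `f` of diameter `< ε`. -/
def IsWStarDentingPoint {X : Type*} [NormedAddCommGroup X] [NormedSpace ℝ X]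
    (f : X →L[ℝ] ℝ) : Prop :=
  ‖f‖ ≤ 1 ∧ ∀ ε > 0, ∃ (x : X) (α : ℝ), ‖x‖ = 1 ∧ 0 < α ∧
    f ∈ wStarSlice X x α ∧ Metric.diam (wStarSlice X x α) < ε

theorem wstar_aux_shrink {X : Type*} [NormedAddCommGroup X] [NormedSpace ℝ X]
    (f : X →L[ℝ] ℝ) (h : IsWStarDentingPoint f) (ε : ℝ) (hε : 0 < ε) :
    ∃ (x : X) (α : ℝ), ‖x‖ = 1 ∧ 0 < α ∧ α ≤ ε ∧ 1 - α < f x ∧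
      ∀ g k : X →L[ℝ] ℝ, ‖g‖ ≤ 1 → ‖k‖ ≤ 1 → 1 - α < g x → 1 - α < k x → ‖g - k‖ ≤ ε := by
  obtain ⟨hf, h⟩ := h
  obtain ⟨x, α, hx, hα, hfx, hd⟩ := h ε hε
  have hb : Bornology.IsBounded (wStarSlice X x α) := by
    refine (Metric.isBounded_closedBall (x := (0 : X →L[ℝ] ℝ)) (r := 1)).subset ?_
    intro g hg
    simpa using hg.1
  have key : ∀ g k : X →L[ℝ] ℝ, ‖g‖ ≤ 1 → ‖k‖ ≤ 1 → 1 - α < g x → 1 - α < k x →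
      ‖g - k‖ < ε := by
    intro g k hg hk hgx hkx
    rw [← dist_eq_norm]
    exact (Metric.dist_le_diam_of_mem hb ⟨hg, hgx⟩ ⟨hk, hkx⟩).trans_lt hd
  have hx0 : x ≠ 0 := by
    intro h0
    simp [h0] at hx
  obtain ⟨g, hg, hgx⟩ := exists_dual_vector ℝ x (by simpa using hx0)
  have hgx' : g x = 1 := by rw [hgx, hx]; simp
  have h1 := key g f hg.le hf (by linarith) hfx.2
  have h2 : (g - f) x ≤ ‖g - f‖ := by
    have := (le_abs_self _).trans ((g - f).le_opNorm x)
    simpa [hx] using this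
  have h3 : (g - f) x = 1 - f x := by simp [hgx']
  refine ⟨x, min α ε, hx, lt_min hα hε, min_le_right _ _, ?_, ?_⟩
  · rcases min_choice α ε with h | h <;> rw [h]
    · exact hfx.2
    · linarith
  · intro g k hg hk hgx hkx
    have := min_le_left α ε
    exact (key g k hg hk (by linarith) (by linarith)).le

theorem wstar_aux_norm {X Y : Type*} [NormedAddCommGroup X] [NormedAddCommGroup Y]
    (u : X) (v : Y) : ‖WithLp.toLp ⊤ (u, v)‖ = max ‖u‖ ‖v‖ := by
  rw [WithLp.prod_norm_eq_sup]; rfl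

/-- If `x₀*` is a w*-denting point of `B_{X*}`, then the functional
`(x,y) ↦ x₀*(x)` on `Z = X ⊕_∞ Y` is a w*-denting point of `B_{Z*}`. -/
theorem wstar_denting_point_of_linfty_sum
    {X Y : Type*} [NormedAddCommGroup X] [NormedSpace ℝ X] [CompleteSpace X]
    [NormedAddCommGroup Y] [NormedSpace ℝ Y] [CompleteSpace Y]
    (x₀' : X →L[ℝ] ℝ) (h : IsWStarDentingPoint x₀') :
    IsWStarDentingPoint
      (x₀'.comp ((ContinuousLinearMap.fst ℝ X Y).comp
        ((WithLp.prodContinuousLinearEquiv ⊤ ℝ X Y : WithLp ⊤ (X × Y) ≃L[ℝ] X × Y) :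
          WithLp ⊤ (X × Y) →L[ℝ] X × Y))) := by
  set F := (x₀'.comp ((ContinuousLinearMap.fst ℝ X Y).comp
        ((WithLp.prodContinuousLinearEquiv ⊤ ℝ X Y : WithLp ⊤ (X × Y) ≃L[ℝ] X × Y) :
          WithLp ⊤ (X × Y) →L[ℝ] X × Y))) with hF
  have hFa : ∀ (u : X) (v : Y), F (WithLp.toLp ⊤ (u, v)) = x₀' u := fun u v => rfl
  have hF1 : ‖F‖ ≤ 1 := by
    refine F.opNorm_le_bound zero_le_one ?_
    rintro ⟨u, v⟩
    rw [hFa, wstar_aux_norm, one_mul]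
    calc ‖x₀' u‖ ≤ 1 * ‖u‖ := x₀'.le_of_opNorm_le h.1 u
      _ ≤ _ := by rw [one_mul]; exact le_max_left _ _
  refine ⟨hF1, ?_⟩
  intro ε hε
  obtain ⟨x, α, hx, hα, hαε, hfx, key⟩ := wstar_aux_shrink x₀' h (ε / 4) (by linarith)
  refine ⟨WithLp.toLp ⊤ (x, 0), α, by rw [wstar_aux_norm]; simp [hx], hα, ⟨hF1, by rwa [hFa]⟩, ?_⟩
  let e : X × Y →L[ℝ] WithLp ⊤ (X × Y) := (WithLp.prodContinuousLinearEquiv ⊤ ℝ X Y).symm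
  let i1 : X →L[ℝ] WithLp ⊤ (X × Y) := e.comp (ContinuousLinearMap.inl ℝ X Y)
  let i2 : Y →L[ℝ] WithLp ⊤ (X × Y) := e.comp (ContinuousLinearMap.inr ℝ X Y)
  have hi1 : ∀ u, i1 u = WithLp.toLp ⊤ (u, 0) := fun u => rfl
  have hi2 : ∀ v, i2 v = WithLp.toLp ⊤ (0, v) := fun v => rfl
  have hadd : ∀ u v, WithLp.toLp ⊤ (u, v) = i1 u + i2 v := by
    intro u v
    rw [hi1, hi2, ← WithLp.toLp_add]; simp
  have n1 : ∀ g ∈ wStarSlice (WithLp ⊤ (X × Y)) (WithLp.toLp ⊤ (x, 0)) α,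
      ‖g.comp i1‖ ≤ 1 := by
    intro g hg
    refine ContinuousLinearMap.opNorm_le_bound _ zero_le_one fun u => ?_
    have := g.le_of_opNorm_le hg.1 (i1 u)
    have h2 : ‖i1 u‖ = ‖u‖ := by rw [hi1, wstar_aux_norm]; simp
    rwa [h2] at this
  have n2 : ∀ g ∈ wStarSlice (WithLp ⊤ (X × Y)) (WithLp.toLp ⊤ (x, 0)) α,
      ‖g.comp i2‖ ≤ α := by
    intro g hg
    refine ContinuousLinearMap.opNorm_le_of_unit_norm hα.le ?_
    have : ∀ v : Y, ‖v‖ = 1 → g (i2 v) ≤ α := by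
      intro v hv
      have h1 := (le_abs_self _).trans (g.le_of_opNorm_le hg.1 (WithLp.toLp ⊤ (x, v)))
      have h2 := hg.2
      rw [wstar_aux_norm, hx, hv, hadd, map_add, hi1] at h1
      simp only [max_self] at h1
      linarith
    intro v hv
    have h1 := this v hv
    have h2 := this (-v) (by simpa using hv)
    rw [map_neg, map_neg] at h2
    exact abs_le.2 ⟨by change -α ≤ g (i2 v); linarith, h1⟩
  have : Metric.diam (wStarSlice (WithLp ⊤ (X × Y)) (WithLp.toLp ⊤ (x, 0)) α) ≤ 3 * (ε / 4) := by
    refine Metric.diam_le_of_forall_dist_le (by linarith) ?_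
    intro g hg k hk
    rw [dist_eq_norm]
    refine ContinuousLinearMap.opNorm_le_bound _ (by linarith) ?_
    rintro ⟨u, v⟩
    have h1 := key (g.comp i1) (k.comp i1) (n1 g hg) (n1 k hk) hg.2 hk.2
    have e1 := (g.comp i1 - k.comp i1).le_of_opNorm_le h1 u
    have e2 := (g.comp i2).le_of_opNorm_le ((n2 g hg).trans hαε) v
    have e3 := (k.comp i2).le_of_opNorm_le ((n2 k hk).trans hαε) v
    have e4 : (g - k) (WithLp.toLp ⊤ (u, v))
        = (g.comp i1 - k.comp i1) u + ((g.comp i2) v - (k.comp i2) v) := by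
      rw [hadd]; simp; ring
    rw [e4, wstar_aux_norm]
    have e5 := norm_add_le ((g.comp i1 - k.comp i1) u) ((g.comp i2) v - (k.comp i2) v)
    have e6 := norm_sub_le ((g.comp i2) v) ((k.comp i2) v)
    have e7 := mul_le_mul_of_nonneg_left (le_max_left ‖u‖ ‖v‖) (show 0 ≤ ε / 4 by linarith)
    have e8 := mul_le_mul_of_nonneg_left (le_max_right ‖u‖ ‖v‖) (show 0 ≤ ε / 4 by linarith)
    linarith
  linarith
end

section
/- Let X be a real Banach space and M ⊆ X a closed subspace that is an M-ideal in X. If m* ∈ B_{M*} is a w*-denting point of B_{M*}, then its (unique) norm-preserving extension to X is a w*-denting point of B_{X*}. -/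
/-- If `M ⊆ X` is an M-ideal (i.e. the annihilator `M^⊥` is the kernel of an
L-projection `P` on `X*`) and `m*` is a w*-denting point of `B_{M*}`, then the
norm-preserving extension of `m*` to `X` is a w*-denting point of `B_{X*}`. -/
theorem wstar_denting_point_of_M_ideal
    {X : Type*} [NormedAddCommGroup X] [NormedSpace ℝ X] [CompleteSpace X]
    (M : Submodule ℝ X) (hMclosed : IsClosed (M : Set X))
    (P : (X →L[ℝ] ℝ) →ₗ[ℝ] (X →L[ℝ] ℝ))
    (hproj : ∀ f, P (P f) = P f)
    (hL : ∀ f : X →L[ℝ] ℝ, ‖f‖ = ‖P f‖ + ‖f - P f‖)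
    (hker : ∀ f : X →L[ℝ] ℝ, P f = 0 ↔ ∀ m ∈ M, f m = 0)
    (m' : ↥M →L[ℝ] ℝ) (hm : IsWStarDentingPoint m')
    (x' : X →L[ℝ] ℝ) (hext : x'.comp M.subtypeL = m') (hnp : ‖x'‖ = ‖m'‖) :
    IsWStarDentingPoint x' := by
  have hPM : ∀ f : X →L[ℝ] ℝ, ∀ m ∈ M, P f m = f m := by
    intro f m hmM
    have h0 : P (f - P f) = 0 := by rw [map_sub, hproj, sub_self]
    have h1 := (hker _).1 h0 m hmM
    have h2 : f m - P f m = 0 := by simpa using h1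
    linarith
  have hPle : ∀ f : X →L[ℝ] ℝ, ‖P f‖ ≤ ‖f.comp M.subtypeL‖ := by
    intro f
    obtain ⟨g, hg, hgn⟩ := exists_extension_norm_eq M (f.comp M.subtypeL)
    have h0 : P (f - g) = 0 := by
      rw [hker]
      intro m hmM
      have h1 := hg ⟨m, hmM⟩
      have h2 : g m = f m := by simpa using h1
      simp [h2]
    have h3 : P f = P g := by rwa [map_sub, sub_eq_zero] at h0
    have h4 := hL g
    have h5 := norm_nonneg (g - P g)
    rw [h3, ← hgn]
    linarith
  have hres : ∀ f : X →L[ℝ] ℝ, ‖f.comp M.subtypeL‖ ≤ ‖f‖ := by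
    intro f
    refine ContinuousLinearMap.opNorm_le_bound _ (norm_nonneg _) fun m => ?_
    simpa using f.le_opNorm (m : X)
  obtain ⟨hm1, hm2⟩ := hm
  refine ⟨hnp ▸ hm1, fun ε hε => ?_⟩
  obtain ⟨m, α, hmn, hα, hmem, hdiam⟩ := hm2 (ε / 4) (by positivity)
  have hbdd : Bornology.IsBounded (wStarSlice M m α) := by
    refine (Metric.isBounded_closedBall (x := (0 : M →L[ℝ] ℝ)) (r := 1)).subset ?_
    intro f hf
    exact mem_closedBall_zero_iff.2 hf.1
  have hmX : ‖(m : X)‖ = 1 := by simpa using hmn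
  have hx'm : x' (m : X) = m' m := by rw [← hext]; rfl
  have hm0 : m ≠ 0 := by
    rintro rfl
    simp at hmn
  obtain ⟨f0, hf0, hf0m⟩ := exists_dual_vector ℝ m (by simpa using hm0)
  have hf0m' : f0 m = 1 := by rw [hf0m, hmn]; simp
  have hf0s : f0 ∈ wStarSlice M m α := ⟨hf0.le, by rw [hf0m']; linarith⟩
  have hclose := Metric.dist_le_diam_of_mem hbdd hf0s hmem
  have hbig : 1 - ε / 4 < m' m := by
    have h1 := (f0 - m').le_opNorm m
    rw [hmn, mul_one, ← dist_eq_norm] at h1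
    have h2 := le_trans (le_abs_self _) h1
    have h3 : (f0 - m') m = 1 - m' m := by rw [← hf0m']; rfl
    linarith
  have hmem2 : 1 - α < m' m := hmem.2
  refine ⟨(m : X), min α (ε / 4), hmX, lt_min hα (by positivity), ⟨hnp ▸ hm1, ?_⟩, ?_⟩
  · rw [hx'm]
    rcases min_choice α (ε / 4) with h | h <;> rw [h] <;> assumption
  have key : ∀ f ∈ wStarSlice X (m : X) (min α (ε / 4)),
      f.comp M.subtypeL ∈ wStarSlice M m α ∧ ‖f - P f‖ ≤ ε / 4 := by
    rintro f ⟨hf1, hf2⟩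
    have ha := min_le_left α (ε / 4)
    have hb := min_le_right α (ε / 4)
    refine ⟨⟨(hres f).trans hf1, ?_⟩, ?_⟩
    · change 1 - α < f (m : X)
      linarith
    · have h1 := (P f).le_opNorm (m : X)
      rw [hmX, mul_one, hPM f m m.2] at h1
      have h2 := le_trans (le_abs_self _) h1
      have h3 := hL f
      linarith
  refine lt_of_le_of_lt (Metric.diam_le_of_forall_dist_le (C := 3 * (ε / 4)) (by positivity) ?_)
    (by linarith)
  intro f hf g hg
  obtain ⟨hf1, hf2⟩ := key f hf
  obtain ⟨hg1, hg2⟩ := key g hg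
  have h1 := Metric.dist_le_diam_of_mem hbdd hf1 hg1
  rw [dist_eq_norm, ← ContinuousLinearMap.sub_comp] at h1
  have h2 := hPle (f - g)
  have h3 : f - g = P (f - g) + ((f - P f) - (g - P g)) := by
    rw [map_sub]; abel
  have h4 := norm_add_le (P (f - g)) ((f - P f) - (g - P g))
  have h5 := norm_sub_le (f - P f) (g - P g)
  rw [← h3] at h4
  rw [dist_eq_norm]
  linarith
end

section
/- Let X be a real Banach space and M ⊆ X a closed subspace that is an M-ideal in X. If M* has the w*-Ball Dentable Property, then X* has the w*-Ball Dentable Property. -/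
/-- `X*` has the w*-Ball Dentable Property: `B_{X*}` has w*-slices of arbitrarily
small diameter. -/
def WStarBDP (X : Type*) [NormedAddCommGroup X] [NormedSpace ℝ X] : Prop :=
  ∀ ε > 0, ∃ (x : X) (α : ℝ), ‖x‖ = 1 ∧ 0 < α ∧ Metric.diam (wStarSlice X x α) < ε

/-- If `M ⊆ X` is an M-ideal (the annihilator `M^⊥` is the kernel of an
L-projection on `X*`) and `M*` has the w*-Ball Dentable Property, then `X*` has the
w*-Ball Dentable Property. -/
theorem wstar_bdp_of_M_ideal
    {X : Type*} [NormedAddCommGroup X] [NormedSpace ℝ X] [CompleteSpace X]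
    (M : Submodule ℝ X) (hMclosed : IsClosed (M : Set X))
    (P : (X →L[ℝ] ℝ) →ₗ[ℝ] (X →L[ℝ] ℝ))
    (hproj : ∀ f, P (P f) = P f)
    (hL : ∀ f : X →L[ℝ] ℝ, ‖f‖ = ‖P f‖ + ‖f - P f‖)
    (hker : ∀ f : X →L[ℝ] ℝ, P f = 0 ↔ ∀ m ∈ M, f m = 0)
    (h : WStarBDP ↥M) :
    WStarBDP X := by
  have hres : ∀ f : X →L[ℝ] ℝ, ‖P f‖ ≤ ‖f.comp M.subtypeL‖ := by
    intro f
    obtain ⟨g, hg, hgn⟩ := _root_.exists_extension_norm_eq M (f.comp M.subtypeL)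
    have h0 : P (f - g) = 0 := by
      rw [hker]
      intro m hm
      have := hg ⟨m, hm⟩
      simp at this
      simp [this]
    rw [map_sub, sub_eq_zero] at h0
    rw [h0, ← hgn, hL g]
    linarith [norm_nonneg (g - P g)]
  intro ε hε
  obtain ⟨m, α, hm, hα, hd⟩ := h (ε / 2) (by linarith)
  have hm' : ‖(m : X)‖ = 1 := hm
  have hrn : ∀ f : X →L[ℝ] ℝ, ‖f‖ ≤ 1 → ‖f.comp M.subtypeL‖ ≤ 1 := by
    intro f hf
    refine ContinuousLinearMap.opNorm_le_bound _ zero_le_one (fun x => ?_)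
    have h1 := f.le_of_opNorm_le hf (x : X)
    simpa using h1
  have hbd : Bornology.IsBounded (wStarSlice M m α) := by
    refine (Metric.isBounded_closedBall (x := (0 : M →L[ℝ] ℝ)) (r := 1)).subset ?_
    intro f hf
    exact mem_closedBall_zero_iff.2 hf.1
  set β := min α (ε / 8) with hβ
  have hβ1 : β ≤ α := min_le_left _ _
  have hβ2 : β ≤ ε / 8 := min_le_right _ _
  have hβ0 : 0 < β := lt_min hα (by linarith)
  have hsm : ∀ f ∈ wStarSlice X (m : X) β, ‖f - P f‖ ≤ β := by
    intro f hf
    obtain ⟨h1, h2⟩ := hf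
    have h3 : P (f - P f) = 0 := by rw [map_sub, hproj, sub_self]
    have h4 := (hker _).1 h3 m m.2
    have h5 := (P f).le_opNorm (m : X)
    rw [hm', mul_one] at h5
    have h6 := le_trans (le_abs_self _) h5
    simp only [sub_apply] at h4
    linarith [hL f]
  have hmem : ∀ f ∈ wStarSlice X (m : X) β, f.comp M.subtypeL ∈ wStarSlice M m α := by
    intro f hf
    refine ⟨hrn f hf.1, ?_⟩
    have := hf.2
    simp only [ContinuousLinearMap.comp_apply, Submodule.subtypeL_apply]
    linarith
  refine ⟨m, β, hm', hβ0, ?_⟩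
  have key : Metric.diam (wStarSlice X (m : X) β) ≤ 2 * β + Metric.diam (wStarSlice M m α) := by
    refine Metric.diam_le_of_forall_dist_le (by have := Metric.diam_nonneg (s := wStarSlice M m α); linarith) ?_
    intro f hf g hg
    have h1 := Metric.dist_le_diam_of_mem hbd (hmem f hf) (hmem g hg)
    rw [dist_eq_norm, ← ContinuousLinearMap.sub_comp] at h1
    have h2 := hres (f - g)
    have h3 : f - g = P (f - g) + ((f - P f) - (g - P g)) := by rw [map_sub]; abel
    have h4 := norm_add_le (P (f - g)) ((f - P f) - (g - P g))
    have h5 := norm_sub_le (f - P f) (g - P g)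
    rw [← h3] at h4
    rw [dist_eq_norm]
    linarith [hsm f hf, hsm g hg]
  linarith
end

section
/- Let K be a compact Hausdorff space having an isolated point and let X be a real Banach space. If X* has the w*-Ball Dentable Property, then C(K,X)* has the w*-Ball Dentable Property, where C(K,X) is the Banach space of continuous X-valued functions on K with the supremum norm. -/
open Classical in
/-- Embedding of `X` at an isolated point. -/
noncomputable def isoEmb {K : Type*} [TopologicalSpace K] [CompactSpace K] [T2Space K]
    {X : Type*} [NormedAddCommGroup X] [NormedSpace ℝ X]
    (k₀ : K) (hk : IsOpen ({k₀} : Set K)) : X →L[ℝ] C(K, X) :=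
  LinearMap.mkContinuous
    { toFun := fun y => ⟨fun k => if k = k₀ then y else 0, by
        have hc : IsClopen ({k₀} : Set K) := ⟨isClosed_singleton, hk⟩
        refine Continuous.if ?_ continuous_const continuous_const
        intro a ha
        have : frontier {x | x = k₀} = ∅ := hc.frontier_eq
        rw [this] at ha
        exact absurd ha (Set.notMem_empty a)⟩
      map_add' := by
        intro a b; ext k; by_cases hh : k = k₀ <;> simp [hh]
      map_smul' := by
        intro a b; ext k; by_cases hh : k = k₀ <;> simp [hh] } 1 (by
    intro y
    rw [ContinuousMap.norm_le _ (by positivity)]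
    intro k
    by_cases hh : k = k₀ <;> simp [hh])

open Classical in
lemma isoEmb_apply {K : Type*} [TopologicalSpace K] [CompactSpace K] [T2Space K]
    {X : Type*} [NormedAddCommGroup X] [NormedSpace ℝ X]
    (k₀ : K) (hk : IsOpen ({k₀} : Set K)) (y : X) (k : K) :
    isoEmb k₀ hk y k = if k = k₀ then y else 0 := rfl

/-- If `K` is a compact Hausdorff space with an isolated point and `X*` has
the w*-Ball Dentable Property, then `C(K,X)*` has the w*-Ball Dentable Property. -/
theorem wstar_bdp_of_continuous_functions
    {K : Type*} [TopologicalSpace K] [CompactSpace K] [T2Space K]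
    {X : Type*} [NormedAddCommGroup X] [NormedSpace ℝ X] [CompleteSpace X]
    (hK : ∃ k₀ : K, IsOpen ({k₀} : Set K))
    (h : WStarBDP X) :
    WStarBDP C(K, X) := by
  classical
  obtain ⟨k₀, hk⟩ := hK
  intro ε hε
  obtain ⟨x, α, hx, hα, hd⟩ := h (ε / 2) (by positivity)
  set J : X →L[ℝ] C(K, X) := isoEmb k₀ hk with hJ
  have hJn : ∀ y, ‖J y‖ ≤ ‖y‖ := by
    intro y
    rw [ContinuousMap.norm_le _ (by positivity)]
    intro k
    rw [hJ, isoEmb_apply]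
    split_ifs <;> simp
  have hJ0 : ∀ y, J y k₀ = y := by
    intro y; rw [hJ, isoEmb_apply]; simp
  have hJ1 : ‖J‖ ≤ 1 := J.opNorm_le_bound zero_le_one (by simpa using hJn)
  -- tail estimate
  have key : ∀ β : ℝ, ∀ φ ∈ wStarSlice C(K, X) (J x) β, ∀ G : C(K, X), ‖G‖ = 1 →
      φ (G - J (G k₀)) ≤ β := by
    rintro β φ ⟨h1, h2⟩ G hG
    have h3 : ‖J x + (G - J (G k₀))‖ ≤ 1 := by
      rw [ContinuousMap.norm_le _ zero_le_one]
      intro k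
      have hGk := G.norm_coe_le_norm k
      by_cases hh : k = k₀
      · subst hh; simp [hJ0, hx]
      · simp only [ContinuousMap.add_apply, ContinuousMap.sub_apply, hJ, isoEmb_apply, if_neg hh]
        simpa [hG] using hGk
    have h4 : ‖φ (J x + (G - J (G k₀)))‖ ≤ 1 :=
      (φ.le_opNorm _).trans (mul_le_one₀ h1 (norm_nonneg _) h3)
    rw [Real.norm_eq_abs, map_add] at h4
    have := (abs_le.1 h4).2
    linarith
  have key2 : ∀ β : ℝ, ∀ φ ∈ wStarSlice C(K, X) (J x) β, ∀ G : C(K, X), ‖G‖ = 1 →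
      |φ (G - J (G k₀))| ≤ β := by
    intro β φ hφ G hG
    rw [abs_le]
    refine ⟨?_, key β φ hφ G hG⟩
    have := key β φ hφ (-G) (by simpa using hG)
    have e : -G - J ((-G) k₀) = -(G - J (G k₀)) := by
      rw [ContinuousMap.neg_apply, map_neg]; abel
    rw [e, map_neg] at this
    linarith
  have hbd : Bornology.IsBounded (wStarSlice X x α) := by
    refine (Metric.isBounded_closedBall (x := (0 : X →L[ℝ] ℝ)) (r := 1)).subset ?_
    rintro f ⟨hf, -⟩
    simpa using hf
  refine ⟨J x, min α (ε / 8), ?_, by positivity, ?_⟩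
  · refine le_antisymm ((hJn x).trans hx.le) ?_
    have := (J x).norm_coe_le_norm k₀
    rwa [hJ0, hx] at this
  have hmem : ∀ φ ∈ wStarSlice C(K, X) (J x) (min α (ε / 8)), φ.comp J ∈ wStarSlice X x α := by
    rintro φ ⟨h1, h2⟩
    refine ⟨(φ.opNorm_comp_le J).trans (mul_le_one₀ h1 (norm_nonneg _) hJ1), ?_⟩
    have := min_le_left α (ε / 8)
    rw [ContinuousLinearMap.comp_apply]
    linarith
  have hd0 : 0 ≤ Metric.diam (wStarSlice X x α) := Metric.diam_nonneg
  refine lt_of_le_of_lt (Metric.diam_le_of_forall_dist_le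
    (C := Metric.diam (wStarSlice X x α) + ε / 4) (by positivity) ?_) (by linarith)
  intro φ hφ ψ hψ
  rw [dist_eq_norm]
  refine ContinuousLinearMap.opNorm_le_of_unit_norm (by positivity) ?_
  intro G hG
  have a1 := key2 _ φ hφ G hG
  have a2 := key2 _ ψ hψ G hG
  have a3 := Metric.dist_le_diam_of_mem hbd (hmem φ hφ) (hmem ψ hψ)
  rw [dist_eq_norm] at a3
  have hGk : ‖G k₀‖ ≤ 1 := hG ▸ G.norm_coe_le_norm k₀
  have a4 := (φ.comp J - ψ.comp J).le_of_opNorm_le_of_le a3 hGk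
  have a5 := min_le_right α (ε / 8)
  rw [Real.norm_eq_abs] at a4 ⊢
  simp only [ContinuousLinearMap.sub_apply, ContinuousLinearMap.comp_apply, map_sub] at a1 a2 a4 ⊢
  rw [abs_le] at *
  constructor <;> linarith [a1.1, a1.2, a2.1, a2.2, a4.1, a4.2]
end

section
/- Let X be a real Banach space and Y ⊆ X a closed subspace that is a strict ideal in X, witnessed by a norm-one projection P on X* with ker P = Y^⊥ and B_{P(X*)} norming for X. If y* ∈ B_{Y*} is a w*-denting point of B_{Y*}, then the corresponding extension P-extension of y* in B_{X*} is a w*-denting point of B_{X*}. -/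
theorem aux_norm {X : Type*} [NormedAddCommGroup X] [NormedSpace ℝ X]
    (Y : Submodule ℝ X) (P : (X →L[ℝ] ℝ) →L[ℝ] (X →L[ℝ] ℝ)) (hP1 : ‖P‖ = 1)
    (hker : ∀ f : X →L[ℝ] ℝ, P f = 0 ↔ ∀ y ∈ Y, f y = 0)
    (h : X →L[ℝ] ℝ) (hh : P h = h) : ‖h‖ ≤ ‖h.comp Y.subtypeL‖ := by
  obtain ⟨g, hg, hn⟩ := exists_extension_norm_eq Y (h.comp Y.subtypeL)
  have h0 : P (g - h) = 0 := by
    rw [hker]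
    intro y hy
    have := hg ⟨y, hy⟩
    simp at this
    simp [this]
  have h1 : P g = h := by
    rw [map_sub, hh] at h0
    exact sub_eq_zero.mp h0
  calc ‖h‖ = ‖P g‖ := by rw [h1]
    _ ≤ ‖P‖ * ‖g‖ := P.le_opNorm g
    _ = _ := by rw [hP1, one_mul, hn]

theorem aux_approx {X : Type*} [NormedAddCommGroup X] [NormedSpace ℝ X]
    (P : (X →L[ℝ] ℝ) →L[ℝ] (X →L[ℝ] ℝ))
    (hproj : ∀ f, P (P f) = P f)
    (hnorming : ∀ x : X,
      ‖x‖ = ⨆ f : {f : X →L[ℝ] ℝ // (∃ g, P g = f) ∧ ‖f‖ ≤ 1}, |f.1 x|)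
    (f : X →L[ℝ] ℝ) (hf : ‖f‖ ≤ 1) (x y : X) (δ : ℝ) (hδ : 0 < δ) :
    ∃ h : X →L[ℝ] ℝ, P h = h ∧ ‖h‖ ≤ 1 ∧ |f x - h x| < δ ∧ |f y - h y| < δ := by
  let T : (X →L[ℝ] ℝ) → ℝ × ℝ := fun h => (h x, h y)
  let C : Set (ℝ × ℝ) := T '' {h | P h = h ∧ ‖h‖ ≤ 1}
  have hC : Convex ℝ C := by
    rintro _ ⟨h, ⟨h1, h2⟩, rfl⟩ _ ⟨k, ⟨k1, k2⟩, rfl⟩ a b ha hb hab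
    refine ⟨a • h + b • k, ⟨by simp [h1, k1], ?_⟩, by simp [T]⟩
    calc ‖a • h + b • k‖ ≤ ‖a • h‖ + ‖b • k‖ := norm_add_le _ _
      _ = a * ‖h‖ + b * ‖k‖ := by
        rw [norm_smul, norm_smul, Real.norm_of_nonneg ha, Real.norm_of_nonneg hb]
      _ ≤ 1 := by nlinarith
  have hmem : T f ∈ closure C := by
    by_contra hn
    obtain ⟨φ, u, h1, h2⟩ := geometric_hahn_banach_closed_point hC.closure isClosed_closure hn
    have key : ∀ h : X →L[ℝ] ℝ, φ (T h) = h (φ (1, 0) • x + φ (0, 1) • y) := by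
      intro h
      have : T h = h x • ((1 : ℝ), (0 : ℝ)) + h y • ((0 : ℝ), (1 : ℝ)) := by simp [T]
      rw [this]
      simp only [map_add, map_smul, smul_eq_mul]
      ring
    have hz : ‖φ (1, 0) • x + φ (0, 1) • y‖ ≤ u := by
      rw [hnorming]
      have : Nonempty {f : X →L[ℝ] ℝ // (∃ g, P g = f) ∧ ‖f‖ ≤ 1} :=
        ⟨⟨0, ⟨0, map_zero P⟩, by simp⟩⟩
      refine ciSup_le ?_
      rintro ⟨h, ⟨g, rfl⟩, hn1⟩
      have a1 := h1 _ (subset_closure ⟨P g, ⟨hproj g, hn1⟩, rfl⟩)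
      have a2 := h1 _ (subset_closure ⟨-P g, ⟨by rw [map_neg, hproj g], by rwa [norm_neg]⟩, rfl⟩)
      rw [key] at a1 a2
      rw [ContinuousLinearMap.neg_apply] at a2
      exact abs_le.mpr ⟨by linarith, a1.le⟩
    rw [key] at h2
    have := f.le_of_opNorm_le hf (φ (1, 0) • x + φ (0, 1) • y)
    have := le_abs_self (f (φ (1, 0) • x + φ (0, 1) • y))
    rw [← Real.norm_eq_abs] at this
    linarith
  obtain ⟨_, ⟨h, ⟨h1, h2⟩, rfl⟩, hd⟩ := Metric.mem_closure_iff.mp hmem δ hδ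
  rw [Prod.dist_eq, max_lt_iff, Real.dist_eq, Real.dist_eq] at hd
  exact ⟨h, h1, h2, hd.1, hd.2⟩

theorem aux_comp {X : Type*} [NormedAddCommGroup X] [NormedSpace ℝ X]
    (Y : Submodule ℝ X) (h : X →L[ℝ] ℝ) (hh : ‖h‖ ≤ 1) : ‖h.comp Y.subtypeL‖ ≤ 1 := by
  refine ContinuousLinearMap.opNorm_le_bound _ zero_le_one fun v => ?_
  exact h.le_of_opNorm_le hh (v : X)

/-- If `Y ⊆ X` is a strict ideal, witnessed by a norm-one projection `P` on
`X*` with `ker P = Y^⊥` whose range has a norming unit ball, and `y*` is a w*-denting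
point of `B_{Y*}`, then the `P`-extension of `y*` (the element of the range of `P`
restricting to `y*` on `Y`) is a w*-denting point of `B_{X*}`. -/
theorem wstar_denting_point_of_strict_ideal
    {X : Type*} [NormedAddCommGroup X] [NormedSpace ℝ X] [CompleteSpace X]
    (Y : Submodule ℝ X) (hYclosed : IsClosed (Y : Set X))
    (P : (X →L[ℝ] ℝ) →L[ℝ] (X →L[ℝ] ℝ))
    (hproj : ∀ f, P (P f) = P f)
    (hP1 : ‖P‖ = 1)
    (hker : ∀ f : X →L[ℝ] ℝ, P f = 0 ↔ ∀ y ∈ Y, f y = 0)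
    (hnorming : ∀ x : X,
      ‖x‖ = ⨆ f : {f : X →L[ℝ] ℝ // (∃ g, P g = f) ∧ ‖f‖ ≤ 1}, |f.1 x|)
    (y' : ↥Y →L[ℝ] ℝ) (hy : IsWStarDentingPoint y')
    (x' : X →L[ℝ] ℝ) (hrange : P x' = x') (hext : x'.comp Y.subtypeL = y') :
    IsWStarDentingPoint x' := by
  refine ⟨(aux_norm Y P hP1 hker x' hrange).trans (by rw [hext]; exact hy.1), fun ε hε => ?_⟩
  obtain ⟨y, α, hy1, hα, hmem, hdiam⟩ := hy.2 ε hε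
  have hx1 : ‖x'‖ ≤ 1 := (aux_norm Y P hP1 hker x' hrange).trans (by rw [hext]; exact hy.1)
  refine ⟨(y : X), α, hy1, hα, ⟨hx1, ?_⟩, lt_of_le_of_lt ?_ hdiam⟩
  · have := hmem.2
    rw [← hext] at this
    exact this
  have hbdd : Bornology.IsBounded (wStarSlice Y y α) :=
    (Metric.isBounded_closedBall (x := (0 : Y →L[ℝ] ℝ)) (r := 1)).subset
      fun f hf => mem_closedBall_zero_iff.mpr hf.1
  refine Metric.diam_le_of_forall_dist_le Metric.diam_nonneg ?_
  rintro f ⟨hf1, hf2⟩ g ⟨hg1, hg2⟩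
  rw [dist_eq_norm]
  refine ContinuousLinearMap.opNorm_le_bound _ Metric.diam_nonneg fun x => ?_
  refine le_of_forall_pos_le_add fun δ hδ => ?_
  obtain ⟨h, h1, h2, h3, h4⟩ := aux_approx P hproj hnorming f hf1 x y
    (min (δ / 2) (f y - (1 - α))) (lt_min (by linarith) (by linarith))
  obtain ⟨k, k1, k2, k3, k4⟩ := aux_approx P hproj hnorming g hg1 x y
    (min (δ / 2) (g y - (1 - α))) (lt_min (by linarith) (by linarith))
  have h5 := h3.trans_le (min_le_left _ _)
  have k5 := k3.trans_le (min_le_left _ _)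
  have h6 := (le_abs_self _).trans_lt (h4.trans_le (min_le_right _ _))
  have k6 := (le_abs_self _).trans_lt (k4.trans_le (min_le_right _ _))
  have hs : h.comp Y.subtypeL ∈ wStarSlice Y y α :=
    ⟨aux_comp Y h h2, show 1 - α < h (y : X) by linarith⟩
  have ks : k.comp Y.subtypeL ∈ wStarSlice Y y α :=
    ⟨aux_comp Y k k2, show 1 - α < k (y : X) by linarith⟩
  have hd := Metric.dist_le_diam_of_mem hbdd hs ks
  rw [dist_eq_norm, ← ContinuousLinearMap.sub_comp] at hd
  have hn := (aux_norm Y P hP1 hker (h - k) (by rw [map_sub, h1, k1])).trans hd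
  have hfin := (h - k).le_of_opNorm_le hn x
  rw [Real.norm_eq_abs, ContinuousLinearMap.sub_apply] at hfin ⊢
  rw [abs_lt] at h5 k5
  rw [abs_le] at hfin ⊢
  constructor <;> linarith [hfin.1, hfin.2, h5.1, h5.2, k5.1, k5.2]
end

section
/- Let X be a real Banach space and Y ⊆ X a closed subspace that is a strict ideal in X. If Y* has the w*-Ball Dentable Property, then X* has the w*-Ball Dentable Property. -/
theorem aux_dense {X : Type*} [NormedAddCommGroup X] [NormedSpace ℝ X]
    (P : (X →L[ℝ] ℝ) →L[ℝ] (X →L[ℝ] ℝ))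
    (hnorming : ∀ x : X,
      ‖x‖ = ⨆ f : {f : X →L[ℝ] ℝ // (∃ g, P g = f) ∧ ‖f‖ ≤ 1}, |f.1 x|)
    (f : X →L[ℝ] ℝ) (hf : ‖f‖ ≤ 1) (y x : X) (c d : ℝ) (hc : c < f y) (hd : d < f x) :
    ∃ h : X →L[ℝ] ℝ, (∃ g, P g = h) ∧ ‖h‖ ≤ 1 ∧ c < h y ∧ d < h x := by
  let K : Set (ℝ × ℝ) := {p | ∃ h : X →L[ℝ] ℝ, (∃ g, P g = h) ∧ ‖h‖ ≤ 1 ∧ p = (h y, h x)}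
  have hK : Convex ℝ K := by
    rintro _ ⟨h1, ⟨g1, e1⟩, n1, rfl⟩ _ ⟨h2, ⟨g2, e2⟩, n2, rfl⟩ a b ha hb hab
    refine ⟨a • h1 + b • h2, ⟨a • g1 + b • g2, by simp [e1, e2]⟩, ?_, by simp⟩
    calc ‖a • h1 + b • h2‖ ≤ ‖a • h1‖ + ‖b • h2‖ := norm_add_le _ _
      _ = a * ‖h1‖ + b * ‖h2‖ := by
        rw [norm_smul, norm_smul, Real.norm_of_nonneg ha, Real.norm_of_nonneg hb]
      _ ≤ 1 := by nlinarith
  have hmem : (f y, f x) ∈ closure K := by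
    by_contra hn
    obtain ⟨φ, u, h1, h2⟩ := geometric_hahn_banach_closed_point hK.closure isClosed_closure hn
    have key : ∀ s t : ℝ, φ (s, t) = s * φ (1, 0) + t * φ (0, 1) := by
      intro s t
      have : ((s, t) : ℝ × ℝ) = s • (1, 0) + t • (0, 1) := by simp
      rw [this, map_add, map_smul, map_smul]; simp
    set z : X := φ (1, 0) • y + φ (0, 1) • x with hz
    have hval : ∀ h : X →L[ℝ] ℝ, φ (h y, h x) = h z := by
      intro h
      rw [key, hz]; simp; ring
    have hb : ‖z‖ ≤ u := by
      rw [hnorming z]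
      have : Nonempty {f : X →L[ℝ] ℝ // (∃ g, P g = f) ∧ ‖f‖ ≤ 1} :=
        ⟨⟨0, ⟨0, by simp⟩, by simp⟩⟩
      apply ciSup_le
      rintro ⟨h, ⟨g, e⟩, n⟩
      have a1 := h1 _ (subset_closure ⟨h, ⟨g, e⟩, n, rfl⟩)
      have a2 := h1 _ (subset_closure ⟨-h, ⟨-g, by simp [e]⟩, by simpa using n, rfl⟩)
      rw [hval] at a1 a2
      simp only [neg_apply] at a2
      exact abs_le.2 ⟨by linarith, a1.le⟩
    rw [hval] at h2
    have h3 : f z ≤ ‖z‖ := (le_abs_self _).trans (by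
      have := f.le_of_opNorm_le hf z
      simpa using this)
    linarith
  have hopen : IsOpen (Set.Ioi c ×ˢ Set.Ioi d) := isOpen_Ioi.prod isOpen_Ioi
  obtain ⟨_, ⟨o1, o2⟩, h, hg, n, rfl⟩ := mem_closure_iff.1 hmem _ hopen ⟨hc, hd⟩
  exact ⟨h, hg, n, o1, o2⟩

/-- If `Y ⊆ X` is a strict ideal (there is a norm-one projection `P` on `X*`
with `ker P = Y^⊥` whose range has a norming unit ball) and `Y*` has the w*-Ball
Dentable Property, then `X*` has the w*-Ball Dentable Property. -/
theorem wstar_bdp_of_strict_ideal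
    {X : Type*} [NormedAddCommGroup X] [NormedSpace ℝ X] [CompleteSpace X]
    (Y : Submodule ℝ X) (hYclosed : IsClosed (Y : Set X))
    (P : (X →L[ℝ] ℝ) →L[ℝ] (X →L[ℝ] ℝ))
    (hproj : ∀ f, P (P f) = P f)
    (hP1 : ‖P‖ = 1)
    (hker : ∀ f : X →L[ℝ] ℝ, P f = 0 ↔ ∀ y ∈ Y, f y = 0)
    (hnorming : ∀ x : X,
      ‖x‖ = ⨆ f : {f : X →L[ℝ] ℝ // (∃ g, P g = f) ∧ ‖f‖ ≤ 1}, |f.1 x|)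
    (h : WStarBDP ↥Y) :
    WStarBDP X := by
  have hnorm : ∀ p : X →L[ℝ] ℝ, P p = p → ‖p‖ ≤ ‖p.comp Y.subtypeL‖ := by
    intro p hp
    obtain ⟨q, hq, hqn⟩ := exists_extension_norm_eq Y (p.comp Y.subtypeL)
    have h0 : P (q - p) = 0 := by
      rw [hker]
      intro y hy
      have := hq ⟨y, hy⟩
      simp at this
      simp [this]
    rw [map_sub, sub_eq_zero, hp] at h0
    rw [← hqn, ← h0]
    have := P.le_opNorm q
    rwa [hP1, one_mul] at this
  intro ε hε
  obtain ⟨y, α, hy, hα, hd⟩ := h ε hε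
  refine ⟨(y : X), α, by simpa using hy, hα, lt_of_le_of_lt ?_ hd⟩
  set D := Metric.diam (wStarSlice Y y α) with hD
  have hD0 : 0 ≤ D := Metric.diam_nonneg
  have hbdd : Bornology.IsBounded (wStarSlice Y y α) := by
    exact isBounded_iff_forall_norm_le.2 ⟨1, fun f hf => hf.1⟩
  have hres : ∀ h : X →L[ℝ] ℝ, ‖h‖ ≤ 1 → 1 - α < h y → h.comp Y.subtypeL ∈ wStarSlice Y y α := by
    intro h hn hh
    refine ⟨?_, by simpa using hh⟩
    refine ContinuousLinearMap.opNorm_le_bound _ zero_le_one fun v => ?_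
    exact h.le_of_opNorm_le hn v
  have hone : ∀ f ∈ wStarSlice X (y : X) α, ∀ g ∈ wStarSlice X (y : X) α, ∀ x : X,
      (f - g) x ≤ D * ‖x‖ := by
    intro f hf g hg x
    refine le_of_forall_pos_le_add fun δ hδ => ?_
    obtain ⟨h1, ⟨g1, e1⟩, n1, c1, d1⟩ := aux_dense P hnorming f hf.1 y x (1 - α) (f x - δ / 2)
      hf.2 (by linarith)
    obtain ⟨h2, ⟨g2, e2⟩, n2, c2, d2⟩ := aux_dense P hnorming g hg.1 y (-x) (1 - α)
      (g (-x) - δ / 2) hg.2 (by linarith)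
    have hdist := Metric.dist_le_diam_of_mem hbdd (hres h1 n1 c1) (hres h2 n2 c2)
    rw [dist_eq_norm, ← ContinuousLinearMap.sub_comp] at hdist
    have hle := (hnorm (h1 - h2) (by rw [← e1, ← e2, map_sub, hproj, hproj])).trans hdist
    have h3 : (h1 - h2) x ≤ D * ‖x‖ :=
      (le_abs_self _).trans ((h1 - h2).le_of_opNorm_le hle x)
    simp only [map_neg, sub_apply] at *
    linarith
  refine Metric.diam_le_of_forall_dist_le hD0 fun f hf g hg => ?_
  rw [dist_eq_norm]
  refine ContinuousLinearMap.opNorm_le_bound _ hD0 fun x => ?_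
  rw [Real.norm_eq_abs]
  refine abs_le.2 ⟨?_, hone f hf g hg x⟩
  have := hone f hf g hg (-x)
  rw [map_neg, norm_neg] at this
  linarith
end

section
/- Let X and Y be real Banach spaces and let Z = X ⊕₁ Y be their ℓ¹-direct sum. If x₀ is a denting point of B_X, then (x₀, 0) is a point of continuity (PC) of B_Z: every net in B_Z converging weakly to (x₀,0) converges to (x₀,0) in norm. -/
/-- If `x₀` is a denting point of `B_X`, then `(x₀, 0)` is a point of
continuity of the unit ball of `Z = X ⊕₁ Y`: every net in `B_Z` converging weakly to
`(x₀, 0)` converges to `(x₀, 0)` in norm. -/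
theorem pc_of_l1_sum
    {X Y : Type*} [NormedAddCommGroup X] [NormedSpace ℝ X] [CompleteSpace X]
    [NormedAddCommGroup Y] [NormedSpace ℝ Y] [CompleteSpace Y]
    (x₀ : X) (h : IsDentingPoint x₀) :
    ∀ {ι : Type*} (l : Filter ι) (z : ι → WithLp 1 (X × Y)), l.NeBot →
      (∀ i, ‖z i‖ ≤ 1) →
      (∀ f : WithLp 1 (X × Y) →L[ℝ] ℝ, Filter.Tendsto (fun i => f (z i)) l
        (nhds (f ((WithLp.equiv 1 (X × Y)).symm (x₀, 0))))) →
      Filter.Tendsto z l (nhds ((WithLp.equiv 1 (X × Y)).symm (x₀, 0))) := by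
  intro ι l z _ hz hw
  obtain ⟨hx1, hd⟩ := h
  have dist_slice : ∀ (f : X →L[ℝ] ℝ) (α : ℝ) (a b : X), a ∈ ballSlice f α →
      b ∈ ballSlice f α → ‖a - b‖ ≤ Metric.diam (ballSlice f α) := by
    intro f α a b ha hb
    rw [← dist_eq_norm]
    refine Metric.dist_le_diam_of_mem ?_ ha hb
    refine (Metric.isBounded_closedBall (x := (0 : X)) (r := 1)).subset ?_
    intro y hy
    simpa using hy.1
  have hx0 : 1 ≤ ‖x₀‖ := by
    refine le_of_forall_pos_lt_add ?_
    intro ε hε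
    obtain ⟨f, α, hf, hα, hxs, hdiam⟩ := hd (ε / 2) (by positivity)
    obtain ⟨y, hy1, hy2⟩ := f.exists_lt_apply_of_lt_opNorm
      (r := max (1 - α) (1 - ε / 2)) (by rw [hf]; exact max_lt (by linarith) (by linarith))
    have key : ∃ w : X, ‖w‖ < 1 ∧ max (1 - α) (1 - ε / 2) < f w := by
      rcases abs_choice (f y) with h' | h'
      · exact ⟨y, hy1, by rwa [Real.norm_eq_abs, h'] at hy2⟩
      · exact ⟨-y, by simpa using hy1, by rw [map_neg]; rwa [Real.norm_eq_abs, h'] at hy2⟩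
    obtain ⟨w, hw1, hw2⟩ := key
    obtain ⟨h3, h4⟩ := max_lt_iff.1 hw2
    have h5 := dist_slice f α w x₀ ⟨hw1.le, h3⟩ hxs
    have h6 : f w ≤ ‖w‖ := by
      have := f.le_opNorm w
      rw [hf, one_mul] at this
      exact (le_abs_self _).trans this
    have h7 := norm_sub_norm_le w x₀
    linarith
  have hnorm : ∀ v : WithLp 1 (X × Y), ‖v‖ = ‖v.fst‖ + ‖v.snd‖ := by
    intro v
    simpa using WithLp.prod_norm_eq_of_nat 1 (by simp) v
  rw [Metric.tendsto_nhds]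
  intro ε hε
  obtain ⟨f, α, hf, hα, hxs, hdiam⟩ := hd (ε / 2) (by positivity)
  have ht := hw (f.comp ((ContinuousLinearMap.fst ℝ X Y).comp
    (WithLp.prodContinuousLinearEquiv 1 ℝ X Y).toContinuousLinearMap))
  have hev := ht.eventually (lt_mem_nhds (a := 1 - α) hxs.2)
  filter_upwards [hev] with i hi
  have hi' : 1 - α < f (z i).fst := hi
  have hzi := hz i
  rw [hnorm] at hzi
  have h5 := dist_slice f α (z i).fst x₀
    ⟨by linarith [norm_nonneg (z i).snd], hi'⟩ hxs
  have h7 := norm_sub_norm_le x₀ (z i).fst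
  rw [norm_sub_rev] at h7
  rw [dist_eq_norm, hnorm]
  have e1 : (z i - (WithLp.equiv 1 (X × Y)).symm (x₀, 0)).fst = (z i).fst - x₀ := rfl
  have e2 : (z i - (WithLp.equiv 1 (X × Y)).symm (x₀, 0)).snd = (z i).snd := by
    change (z i).snd - 0 = _
    simp
  rw [e1, e2]
  linarith
end
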